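/- arXiv:1910.13618 — 2 statements merged into one kernel-verified Lean document; each statement's English description precedes it below -/
import Mathlib

section
/- Let n, m, k be positive integers with k ≤ m, let 1 ≤ p ≤ 2, and let A ∈ ℝ^{n×m}. Then there exist a tuple J = (j_1, …, j_k) of column indices of A and a matrix Y ∈ ℝ^{k×m} such that ‖A − A_J Y‖_p ≤ (k+1)^{1/p} · inf{ ‖A − X‖_p : X ∈ ℝ^{n×m}, rank(X) ≤ k }. -/
/-- Entry-wise ℓp norm of a real matrix. -/
noncomputable def lpNorm {n m : ℕ} (p : ℝ) (A : Matrix (Fin n) (Fin m) ℝ) : ℝ :=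
  (∑ i, ∑ j, |A i j| ^ p) ^ (1 / p)

open Finset

/-- exchange sum -/
noncomputable def exch {k m : ℕ} (δ : Fin m → ℂ) (d : (Fin k → Fin m) → ℂ)
    (T : (Fin k → Fin m) × Fin m) : ℂ :=
  δ T.2 * d T.1 - ∑ i, δ (T.1 i) * d (Function.update T.1 i T.2)

def swp {k m : ℕ} (i : Fin k) : Equiv.Perm ((Fin k → Fin m) × Fin m) :=
  Function.Involutive.toPerm (fun T => (Function.update T.1 i T.2, T.1 i)) (by
    intro T; simp)

lemma swp_apply {k m : ℕ} (i : Fin k) (T : (Fin k → Fin m) × Fin m) :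
    swp i T = (Function.update T.1 i T.2, T.1 i) := rfl

lemma sum_swp {k m : ℕ} {M : Type*} [AddCommMonoid M] (i : Fin k)
    (f : (Fin k → Fin m) × Fin m → M) :
    ∑ T : (Fin k → Fin m) × Fin m, f (Function.update T.1 i T.2, T.1 i) = ∑ T, f T := by
  simpa [swp_apply] using Equiv.sum_comp (swp i) f

lemma sum_T0 {k m : ℕ} (δ : Fin m → ℝ) (d : (Fin k → Fin m) → ℝ) :
    ∑ T : (Fin k → Fin m) × Fin m, δ T.2 * d T.1 = (∑ j, δ j) * ∑ J, d J := by
  rw [Fintype.sum_prod_type, Finset.sum_mul_sum, Finset.sum_comm]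

lemma exch_one {k m : ℕ} (δ : Fin m → ℂ) (d : (Fin k → Fin m) → ℂ) :
    ∑ T, ‖exch δ d T‖ ≤ (k + 1) * ((∑ j, ‖δ j‖) * ∑ J, ‖d J‖) := by
  have h : ∀ T, ‖exch δ d T‖ ≤ ‖δ T.2‖ * ‖d T.1‖ +
      ∑ i, ‖δ (T.1 i)‖ * ‖d (Function.update T.1 i T.2)‖ := by
    intro T
    unfold exch
    refine (norm_sub_le _ _).trans ?_
    rw [norm_mul]
    gcongr
    refine (norm_sum_le _ _).trans ?_
    simp
  refine (Finset.sum_le_sum fun T _ => h T).trans ?_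
  rw [Finset.sum_add_distrib, Finset.sum_comm]
  have h2 : ∀ i : Fin k, ∑ T : (Fin k → Fin m) × Fin m,
      ‖δ (T.1 i)‖ * ‖d (Function.update T.1 i T.2)‖ = (∑ j, ‖δ j‖) * ∑ J, ‖d J‖ := by
    intro i
    rw [← sum_T0]
    exact sum_swp i (fun T => ‖δ T.2‖ * ‖d T.1‖)
  rw [Finset.sum_congr rfl fun i _ => h2 i, sum_T0 (fun j => ‖δ j‖) (fun J => ‖d J‖)]
  simp
  linarith

/-- key nonnegativity of the cross term -/
lemma cross_nonneg {k m : ℕ} (δ : Fin m → ℂ) (d : (Fin k → Fin m) → ℂ) (i : Fin k) :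
    0 ≤ (∑ T : (Fin k → Fin m) × Fin m, δ T.2 * d T.1 *
      (starRingEnd ℂ) (δ (T.1 i) * d (Function.update T.1 i T.2))).re := by
  -- average over the i-th coordinate
  rw [Fintype.sum_prod_type]
  rcases Nat.eq_zero_or_pos k with h0 | h0
  · subst h0; exact i.elim0
  obtain ⟨k, rfl⟩ : ∃ k', k = k' + 1 := ⟨k - 1, by omega⟩
  rw [← (Fin.insertNthEquiv (fun _ => Fin m) i).sum_comp, Fintype.sum_prod_type_right]
  have hE : ∀ (a : Fin m) (R : Fin k → Fin m),
      (Fin.insertNthEquiv (fun _ => Fin m) i) (a, R) = i.insertNth a R := fun _ _ => rfl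
  simp only [hE, Fin.insertNth_apply_same, Fin.update_insertNth]
  rw [Complex.re_sum]
  refine Finset.sum_nonneg fun R _ => ?_
  have : ∑ a : Fin m, ∑ j : Fin m, δ j * d (i.insertNth a R) *
      (starRingEnd ℂ) (δ a * d (i.insertNth j R)) =
      (∑ a : Fin m, d (i.insertNth a R) * (starRingEnd ℂ) (δ a)) *
      (starRingEnd ℂ) (∑ a : Fin m, d (i.insertNth a R) * (starRingEnd ℂ) (δ a)) := by
    rw [map_sum, Finset.sum_mul_sum]
    refine Finset.sum_congr rfl fun a _ => Finset.sum_congr rfl fun b _ => ?_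
    simp
    ring
  rw [this, Complex.mul_conj, Complex.ofReal_re]
  exact Complex.normSq_nonneg _

lemma cross_swap {k m : ℕ} (δ : Fin m → ℂ) (d : (Fin k → Fin m) → ℂ)
    (hd : ∀ J i l, i ≠ l → d (J ∘ Equiv.swap i l) = - d J) (i l : Fin k) (hil : i ≠ l) :
    ∑ T : (Fin k → Fin m) × Fin m, (δ (T.1 i) * d (Function.update T.1 i T.2)) *
      (starRingEnd ℂ) (δ (T.1 l) * d (Function.update T.1 l T.2)) =
    - ∑ T : (Fin k → Fin m) × Fin m, δ T.2 * d T.1 *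
      (starRingEnd ℂ) (δ (T.1 l) * d (Function.update T.1 l T.2)) := by
  rw [← sum_swp i, ← Finset.sum_neg_distrib]
  refine Finset.sum_congr rfl fun T _ => ?_
  have e : Function.update (Function.update T.1 i T.2) l (T.1 i) =
      (Function.update T.1 l T.2) ∘ Equiv.swap i l := by
    funext x
    by_cases h1 : x = i
    · subst h1; simp [hil]
    by_cases h2 : x = l
    · subst h2; simp [hil]
    simp [h1, h2, Equiv.swap_apply_of_ne_of_ne]
  simp only [Function.update_self, Function.update_idem, Function.update_eq_self,
    Function.update_of_ne hil.symm, e, hd _ i l hil]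
  simp

lemma exch_two {k m : ℕ} (δ : Fin m → ℂ) (d : (Fin k → Fin m) → ℂ)
    (hd : ∀ J i l, i ≠ l → d (J ∘ Equiv.swap i l) = - d J) :
    ∑ T, ‖exch δ d T‖ ^ 2 ≤ (k + 1) * ((∑ j, ‖δ j‖ ^ 2) * ∑ J, ‖d J‖ ^ 2) := by
  set t0 : (Fin k → Fin m) × Fin m → ℂ := fun T => δ T.2 * d T.1 with ht0
  set t : Fin k → (Fin k → Fin m) × Fin m → ℂ :=
    fun i T => δ (T.1 i) * d (Function.update T.1 i T.2) with ht
  set c : Fin k → ℝ := fun i => (∑ T, t0 T * (starRingEnd ℂ) (t i T)).re with hc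
  have hc0 : ∀ i, 0 ≤ c i := fun i => cross_nonneg δ d i
  set N : ℝ := (∑ j, ‖δ j‖ ^ 2) * ∑ J, ‖d J‖ ^ 2 with hN
  have hN0 : ∑ T, ‖t0 T‖ ^ 2 = N := by
    rw [hN, ← sum_T0]; simp [ht0, mul_pow]
  have hNi : ∀ i, ∑ T, ‖t i T‖ ^ 2 = N := by
    intro i; rw [← hN0]; exact sum_swp i (fun T => ‖t0 T‖ ^ 2)
  have hcc : ∀ i l, i ≠ l → (∑ T, t i T * (starRingEnd ℂ) (t l T)).re = - c l := by
    intro i l h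
    rw [hc]; simp only [ht, ht0]
    rw [cross_swap δ d hd i l h, Complex.neg_re]
  have hexp : ∀ T, ‖exch δ d T‖ ^ 2 = ‖t0 T‖ ^ 2 - 2 * ∑ i, (t0 T * (starRingEnd ℂ) (t i T)).re
      + ∑ l, ∑ i, (t i T * (starRingEnd ℂ) (t l T)).re := by
    intro T
    have : exch δ d T = t0 T - ∑ i, t i T := rfl
    rw [this, ← Complex.normSq_eq_norm_sq, Complex.normSq_sub, Complex.normSq_eq_norm_sq]
    have e1 : (t0 T * (starRingEnd ℂ) (∑ i, t i T)).re =
        ∑ i, (t0 T * (starRingEnd ℂ) (t i T)).re := by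
      rw [map_sum, Finset.mul_sum, Complex.re_sum]
    have e2 : Complex.normSq (∑ i, t i T) = ∑ l, ∑ i, (t i T * (starRingEnd ℂ) (t l T)).re := by
      have : ((Complex.normSq (∑ i, t i T) : ℝ) : ℂ).re =
        ∑ l, ∑ i, (t i T * (starRingEnd ℂ) (t l T)).re := by
        rw [← Complex.mul_conj, map_sum, Finset.sum_mul_sum, Finset.sum_comm, Complex.re_sum]
        exact Finset.sum_congr rfl fun i _ => Complex.re_sum _ _
      simpa using this
    rw [e1, e2]; ring
  simp_rw [hexp]
  rw [Finset.sum_add_distrib, Finset.sum_sub_distrib, hN0, ← Finset.mul_sum, Finset.sum_comm]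
  have e3 : ∑ i, ∑ T, (t0 T * (starRingEnd ℂ) (t i T)).re = ∑ i, c i :=
    Finset.sum_congr rfl fun i _ => by rw [hc]; exact (Complex.re_sum _ _).symm
  have e4 : ∑ T, ∑ l, ∑ i, (t i T * (starRingEnd ℂ) (t l T)).re ≤ k * N := by
    rw [Finset.sum_comm]
    have : ∀ l ∈ (univ : Finset (Fin k)),
        ∑ T, ∑ i, (t i T * (starRingEnd ℂ) (t l T)).re ≤ N := by
      intro l _
      rw [Finset.sum_comm, ← Finset.add_sum_erase _ _ (mem_univ l)]
      have a1 : ∑ T, (t l T * (starRingEnd ℂ) (t l T)).re = N := by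
        rw [← hNi l]
        refine Finset.sum_congr rfl fun T _ => ?_
        rw [Complex.mul_conj, Complex.ofReal_re, Complex.normSq_eq_norm_sq]
      have a2 : ∑ i ∈ univ.erase l, ∑ T, (t i T * (starRingEnd ℂ) (t l T)).re ≤ 0 := by
        refine Finset.sum_nonpos fun i hi => ?_
        rw [← Complex.re_sum, hcc i l (Finset.ne_of_mem_erase hi)]
        linarith [hc0 l]
      linarith
    refine (Finset.sum_le_sum this).trans ?_
    simp
  have e5 : 0 ≤ ∑ i, c i := Finset.sum_nonneg fun i _ => hc0 i
  rw [e3]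
  linarith


/-- signed complex power -/
noncomputable def spow (x : ℝ) (z : ℂ) : ℂ :=
  if x = 0 then 0 else (SignType.sign x : ℝ) * Complex.exp (z * (Real.log |x| : ℝ))

lemma spow_neg (x : ℝ) (z : ℂ) : spow (-x) z = - spow x z := by
  unfold spow
  by_cases h : x = 0
  · simp [h]
  · simp [h, Left.sign_neg]

lemma norm_spow (x : ℝ) (hx : x ≠ 0) (z : ℂ) : ‖spow x z‖ = |x| ^ z.re := by
  have hs : ‖(((SignType.sign x : SignType) : ℝ) : ℂ)‖ = 1 := by
    rcases lt_or_gt_of_ne hx with h | h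
    · simp [sign_neg h]
    · simp [sign_pos h]
  rw [spow, if_neg hx, norm_mul, hs, one_mul, Complex.norm_exp,
    Real.rpow_def_of_pos (abs_pos.2 hx), Complex.re_mul_ofReal, mul_comm]

lemma norm_spow_pos (x : ℝ) (z : ℂ) (hz : 0 < z.re) : ‖spow x z‖ = |x| ^ z.re := by
  by_cases hx : x = 0
  · simp [hx, spow, Real.zero_rpow hz.ne']
  · exact norm_spow x hx z

lemma norm_spow_le_one (x : ℝ) (z : ℂ) (hz : z.re = 0) : ‖spow x z‖ ≤ 1 := by
  by_cases hx : x = 0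
  · simp [hx, spow]
  · rw [norm_spow x hx, hz, Real.rpow_zero]

lemma norm_spow_le (x : ℝ) (z : ℂ) (hz0 : 0 ≤ z.re) (hz2 : z.re ≤ 2) :
    ‖spow x z‖ ≤ (1 + |x|) ^ (2 : ℝ) := by
  by_cases hx : x = 0
  · simp [hx, spow]
  · rw [norm_spow x hx]
    calc |x| ^ z.re ≤ (1 + |x|) ^ z.re := by
          apply Real.rpow_le_rpow (abs_nonneg _) (by linarith) hz0
      _ ≤ _ := Real.rpow_le_rpow_of_exponent_le (by linarith [abs_nonneg x]) hz2

lemma spow_one (x : ℝ) : spow x 1 = x := by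
  unfold spow
  by_cases h : x = 0
  · simp [h]
  · rw [if_neg h, one_mul, ← Complex.ofReal_exp, Real.exp_log (abs_pos.2 h), ← Complex.ofReal_mul,
      sign_mul_abs]

lemma spow_mul_self (x : ℝ) (p : ℝ) (hp : 0 < p) : spow x ((p - 1 : ℝ) : ℂ) * x = ((|x| ^ p : ℝ) : ℂ) := by
  unfold spow
  by_cases h : x = 0
  · simp [h, Real.zero_rpow hp.ne']
  · rw [if_neg h, ← Complex.ofReal_mul, ← Complex.ofReal_exp, ← Complex.ofReal_mul,
      ← Complex.ofReal_mul]
    congr 1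
    have : |x| ^ p = |x| ^ (p - 1) * |x| := by
      rw [← Real.rpow_add_one (abs_pos.2 h).ne']; simp
    rw [this, Real.rpow_def_of_pos (abs_pos.2 h), mul_comm (p - 1), mul_right_comm, sign_mul_self, mul_comm]

lemma spow_diff (x : ℝ) : Differentiable ℂ (spow x) := by
  unfold spow
  by_cases h : x = 0
  · simp [h]
  · simp only [h, if_false]; fun_prop

lemma exch_p {k m : ℕ} (p : ℝ) (hp1 : 1 ≤ p) (hp2 : p ≤ 2) (δ : Fin m → ℝ)
    (d : (Fin k → Fin m) → ℝ)
    (hd : ∀ J i l, i ≠ l → d (J ∘ Equiv.swap i l) = - d J) :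
    ∑ T : (Fin k → Fin m) × Fin m,
      |δ T.2 * d T.1 - ∑ i, δ (T.1 i) * d (Function.update T.1 i T.2)| ^ p ≤
      (k + 1) * ((∑ j, |δ j| ^ p) * ∑ J, |d J| ^ p) := by
  set e : (Fin k → Fin m) × Fin m → ℝ := fun T =>
    δ T.2 * d T.1 - ∑ i, δ (T.1 i) * d (Function.update T.1 i T.2) with he
  set S : ℝ := ∑ T, |e T| ^ p with hS
  set D : ℝ := ∑ j, |δ j| ^ p with hD
  set G : ℝ := ∑ J, |d J| ^ p with hG
  have hD0 : 0 ≤ D := Finset.sum_nonneg fun _ _ => by positivity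
  have hG0 : 0 ≤ G := Finset.sum_nonneg fun _ _ => by positivity
  have hS0 : 0 ≤ S := Finset.sum_nonneg fun _ _ => by positivity
  set C : ℝ := (k + 1) * (D * G) with hC
  have hC0 : 0 ≤ C := by positivity
  change S ≤ C
  rcases hS0.eq_or_lt with h | hSpos
  · rw [← h]; exact hC0
  let w : ℂ → ℂ := fun z => p * (1 - z / 2)
  let v : ℂ → ℂ := fun z => p * (z / 2)
  have hw : ∀ z, (w z).re = p * (1 - z.re / 2) := by
    intro z; simp [w]
  have hv : ∀ z, (v z).re = p * (z.re / 2) := by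
    intro z; simp [v]
  let δz : ℂ → Fin m → ℂ := fun z j => spow (δ j) (w z)
  let dz : ℂ → (Fin k → Fin m) → ℂ := fun z J => spow (d J) (w z)
  let f : ℂ → ℂ := fun z => ∑ T, spow (e T) (v z) * exch (δz z) (dz z) T
  have hdz : ∀ z J i l, i ≠ l → dz z (J ∘ Equiv.swap i l) = - dz z J := by
    intro z J i l h
    simp only [dz, hd J i l h, spow_neg]
  have hdiff : Differentiable ℂ f := by
    have hw' : Differentiable ℂ w := by simp only [w]; fun_prop
    have hv' : Differentiable ℂ v := by simp only [v]; fun_prop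
    have h1 : ∀ x, Differentiable ℂ fun z => spow x (w z) := fun x => (spow_diff x).comp hw'
    have h2 : ∀ x, Differentiable ℂ fun z => spow x (v z) := fun x => (spow_diff x).comp hv'
    simp only [f, exch, δz, dz]
    fun_prop
  have hB : BddAbove ((norm ∘ f) '' Complex.HadamardThreeLines.verticalClosedStrip 0 1) := by
    refine ⟨(∑ T, (1 + |e T|) ^ (2:ℝ)) *
      ((k + 1) * ((∑ j, (1 + |δ j|) ^ (2:ℝ)) * ∑ J, (1 + |d J|) ^ (2:ℝ))), ?_⟩
    rintro _ ⟨z, hz, rfl⟩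
    have hz' : 0 ≤ z.re ∧ z.re ≤ 1 := hz
    obtain ⟨hz0, hz1⟩ := hz'
    have w0 : 0 ≤ (w z).re := by rw [hw]; apply mul_nonneg <;> linarith
    have w2 : (w z).re ≤ 2 := by rw [hw]; nlinarith
    have v0 : 0 ≤ (v z).re := by rw [hv]; apply mul_nonneg <;> linarith
    have v2 : (v z).re ≤ 2 := by rw [hv]; nlinarith
    have hE : ∀ T, ‖exch (δz z) (dz z) T‖ ≤
        (k + 1) * ((∑ j, (1 + |δ j|) ^ (2:ℝ)) * ∑ J, (1 + |d J|) ^ (2:ℝ)) := by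
      intro T
      refine (Finset.single_le_sum (f := fun T => ‖exch (δz z) (dz z) T‖)
        (fun _ _ => norm_nonneg _) (mem_univ T)).trans ((exch_one _ _).trans ?_)
      gcongr with j _ J _
      · exact norm_spow_le _ _ w0 w2
      · exact norm_spow_le _ _ w0 w2
    change ‖f z‖ ≤ _
    refine (norm_sum_le _ _).trans ?_
    rw [Finset.sum_mul]
    refine Finset.sum_le_sum fun T _ => ?_
    rw [norm_mul]
    exact mul_le_mul (norm_spow_le _ _ v0 v2) (hE T) (norm_nonneg _) (by positivity)
  have ha : ∀ z ∈ Complex.re ⁻¹' {(0:ℝ)}, ‖f z‖ ≤ C := by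
    intro z hz
    have hz : z.re = 0 := hz
    have w0 : (w z).re = p := by rw [hw, hz]; ring
    have v0 : (v z).re = 0 := by rw [hv, hz]; ring
    refine (norm_sum_le _ _).trans ?_
    have : ∑ T, ‖spow (e T) (v z) * exch (δz z) (dz z) T‖ ≤ ∑ T, ‖exch (δz z) (dz z) T‖ := by
      refine Finset.sum_le_sum fun T _ => ?_
      rw [norm_mul]
      exact mul_le_of_le_one_left (norm_nonneg _) (norm_spow_le_one _ _ v0)
    refine this.trans ((exch_one _ _).trans (le_of_eq ?_))
    rw [hC, hD, hG]
    have hp0 : 0 < (w z).re := by rw [w0]; linarith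
    simp only [δz, dz, norm_spow_pos _ _ hp0, w0]
  have hb : ∀ z ∈ Complex.re ⁻¹' {(1:ℝ)}, ‖f z‖ ≤ Real.sqrt S * Real.sqrt C := by
    intro z hz
    have hz : z.re = 1 := hz
    have w0 : (w z).re = p / 2 := by rw [hw, hz]; ring
    have v0 : (v z).re = p / 2 := by rw [hv, hz]; ring
    have hp0 : 0 < (w z).re := by rw [w0]; linarith
    have hp0' : 0 < (v z).re := by rw [v0]; linarith
    have hsq : ∀ x : ℝ, (|x| ^ (p / 2)) ^ 2 = |x| ^ p := by
      intro x
      rw [← Real.rpow_natCast, ← Real.rpow_mul (abs_nonneg x)]; congr 1; push_cast; ring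
    refine (norm_sum_le _ _).trans ?_
    simp only [norm_mul]
    refine (Real.sum_mul_le_sqrt_mul_sqrt _ _ _).trans ?_
    refine mul_le_mul (le_of_eq ?_) (Real.sqrt_le_sqrt ?_) (Real.sqrt_nonneg _) (Real.sqrt_nonneg _)
    · simp only [norm_spow_pos _ _ hp0', v0, hsq, hS]
    · refine (exch_two _ _ (hdz z)).trans (le_of_eq ?_)
      simp only [δz, dz, norm_spow_pos _ _ hp0, w0, hsq, hC, hD, hG]
  set θ : ℝ := 2 - 2 / p with hθ
  have hp0 : 0 < p := by linarith
  have hθ0 : 0 ≤ θ := by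
    rw [hθ, sub_nonneg, div_le_iff₀ hp0]; linarith
  have hθ1 : θ ≤ 1 := by
    have : 1 ≤ 2 / p := by rw [le_div_iff₀ hp0]; linarith
    linarith
  have key := Complex.HadamardThreeLines.norm_le_interp_of_mem_verticalClosedStrip₀₁' f
    (z := (θ : ℂ)) (a := C) (b := Real.sqrt S * Real.sqrt C) (by
      change (θ : ℂ).re ∈ Set.Icc 0 1; simp [hθ0, hθ1]) hdiff.diffContOnCl hB ha hb
  have hwθ : w θ = 1 := by
    have : p * (1 - θ / 2) = 1 := by rw [hθ]; field_simp; ring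
    simp only [w]; exact_mod_cast this
  have hvθ : v θ = ((p - 1 : ℝ) : ℂ) := by
    have : p * (θ / 2) = p - 1 := by rw [hθ]; field_simp
    simp only [v]; exact_mod_cast this
  have hfθ : f θ = (S : ℂ) := by
    simp only [f, hvθ, δz, dz, hwθ, spow_one, hS]
    rw [Complex.ofReal_sum]
    refine Finset.sum_congr rfl fun T _ => ?_
    rw [← spow_mul_self _ _ hp0]
    congr 1
    simp [exch, he]
  rw [hfθ, Complex.norm_real, Real.norm_of_nonneg hS0, Complex.ofReal_re, ← Real.sqrt_mul hS0] at key
  by_contra hlt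
  push Not at hlt
  have h1 : C ^ (1 - θ) * Real.sqrt (S * C) ^ θ < S := by
    by_cases hθz : θ = 0
    · simp [hθz, hlt]
    have hθp : 0 < θ := lt_of_le_of_ne hθ0 (Ne.symm hθz)
    have hsc : Real.sqrt (S * C) < S := by
      rw [Real.sqrt_lt' hSpos]; nlinarith
    have a1 : C ^ (1 - θ) ≤ S ^ (1 - θ) := Real.rpow_le_rpow hC0 hlt.le (by linarith)
    have a2 : Real.sqrt (S * C) ^ θ < S ^ θ := Real.rpow_lt_rpow (Real.sqrt_nonneg _) hsc hθp
    calc _ ≤ S ^ (1 - θ) * Real.sqrt (S * C) ^ θ := by gcongr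
      _ < S ^ (1 - θ) * S ^ θ := by gcongr
      _ = S := by rw [← Real.rpow_add hSpos]; simp
  linarith

lemma extend_li {m r : ℕ} (t : ℕ) (hr : r ≤ t) (ht : t ≤ m) (v : Fin r → (Fin m → ℝ))
    (hv : LinearIndependent ℝ v) :
    ∃ u : Fin t → (Fin m → ℝ), LinearIndependent ℝ u ∧
      Submodule.span ℝ (Set.range v) ≤ Submodule.span ℝ (Set.range u) := by
  induction t, hr using Nat.le_induction with
  | base => exact ⟨v, hv, le_rfl⟩
  | succ t hrt ih =>
    obtain ⟨u, hu, hle⟩ := ih (by omega)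
    obtain ⟨x, hx⟩ := exists_linearIndependent_snoc_of_lt_finrank hu (by simp; omega)
    refine ⟨_, hx, hle.trans (Submodule.span_mono ?_)⟩
    rintro _ ⟨i, rfl⟩
    exact ⟨i.castSucc, by simp⟩

lemma exists_factor {n m k : ℕ} (hkm : k ≤ m) (X : Matrix (Fin n) (Fin m) ℝ) (hX : X.rank ≤ k) :
    ∃ (U : Matrix (Fin n) (Fin k) ℝ) (V : Matrix (Fin k) (Fin m) ℝ),
      X = U * V ∧ ∃ J : Fin k → Fin m, (V.submatrix id J).det ≠ 0 := by
  obtain ⟨v, hvX, hvs, hvl⟩ := Submodule.exists_fun_fin_finrank_span_eq ℝ (Set.range X.row)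
  have hr := X.rank_eq_finrank_span_row
  obtain ⟨u, hu, hle⟩ := extend_li k (by rw [← hr]; exact hX) hkm v hvl
  have hmem : ∀ i, X.row i ∈ Submodule.span ℝ (Set.range u) := by
    intro i
    apply hle
    rw [hvs]
    exact Submodule.subset_span ⟨i, rfl⟩
  have hc : ∀ i, ∃ c : Fin k → ℝ, ∑ l, c l • u l = X.row i := fun i =>
    (Submodule.mem_span_range_iff_exists_fun ℝ).1 (hmem i)
  choose U hU using hc
  refine ⟨Matrix.of U, Matrix.of u, ?_, ?_⟩
  · ext i j
    have := congrFun (hU i) j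
    simp only [Matrix.row] at this
    rw [← this]
    simp [Matrix.mul_apply]
  · have hrk : (Matrix.of u).rank = k := by
      have := LinearIndependent.rank_matrix (M := Matrix.of u) hu
      simpa using this
    rw [Matrix.rank_eq_finrank_span_cols] at hrk
    obtain ⟨w, hw, hws, hwl⟩ := Submodule.exists_fun_fin_finrank_span_eq ℝ
      (Set.range (Matrix.of u).col)
    choose J hJ using hw
    have hli : LinearIndependent ℝ fun i : Fin k => w (Fin.cast hrk.symm i) :=
      hwl.comp _ (Fin.cast_injective _)
    refine ⟨fun i => J (Fin.cast hrk.symm i), ?_⟩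
    have h3 : LinearIndependent ℝ
        ((Matrix.of u).submatrix id fun i => J (Fin.cast hrk.symm i)).col := by
      convert hli using 2 with i
      rw [← hJ]
      rfl
    rw [Matrix.linearIndependent_cols_iff_isUnit, Matrix.isUnit_iff_isUnit_det] at h3
    exact h3.ne_zero

lemma closed_rank {n m k : ℕ} : IsClosed {X : Matrix (Fin n) (Fin m) ℝ | X.rank ≤ k} := by
  rw [← isOpen_compl_iff]
  have : {X : Matrix (Fin n) (Fin m) ℝ | X.rank ≤ k}ᶜ =
      ⋃ J : Fin (k + 1) → Fin m, {X | LinearIndependent ℝ (fun i => X.col (J i))} := by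
    ext X
    simp only [Set.mem_compl_iff, Set.mem_ofPred_eq, not_le, Set.mem_iUnion]
    constructor
    · intro h
      obtain ⟨w, hw, hws, hwl⟩ := Submodule.exists_fun_fin_finrank_span_eq ℝ (Set.range X.col)
      rw [Matrix.rank_eq_finrank_span_cols] at h
      choose J hJ using hw
      refine ⟨fun i => J (Fin.castLE h i), ?_⟩
      simp only [hJ]
      exact hwl.comp _ (Fin.castLE_injective h)
    · rintro ⟨J, hJ⟩
      have h1 := LinearIndependent.rank_matrix (M := (X.submatrix id J).transpose) hJ
      rw [Matrix.rank_transpose] at h1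
      have h2 := Matrix.rank_submatrix_le X id J
      simp at h1
      omega
  rw [this]
  refine isOpen_iUnion fun J => ?_
  refine (isOpen_setOfPred_linearIndependent (𝕜 := ℝ) (E := Fin n → ℝ)).preimage
    (f := fun (X : Matrix (Fin n) (Fin m) ℝ) (i : Fin (k+1)) => X.col (J i)) ?_
  refine continuous_pi fun i => continuous_pi fun a => ?_
  exact continuous_id.matrix_elem a (J i)

lemma lpNorm_nonneg {n m : ℕ} (p : ℝ) (A : Matrix (Fin n) (Fin m) ℝ) : 0 ≤ lpNorm p A := by
  unfold lpNorm; positivity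

lemma exists_opt {n m k : ℕ} (p : ℝ) (hp : 1 ≤ p) (A : Matrix (Fin n) (Fin m) ℝ) :
    ∃ X : Matrix (Fin n) (Fin m) ℝ, X.rank ≤ k ∧
      ∀ Z : Matrix (Fin n) (Fin m) ℝ, Z.rank ≤ k → lpNorm p (A - X) ≤ lpNorm p (A - Z) := by
  have hp0 : 0 < p := by linarith
  have hcont : Continuous fun X : Matrix (Fin n) (Fin m) ℝ => lpNorm p (A - X) := by
    unfold lpNorm
    refine Continuous.rpow_const ?_ (fun _ => Or.inr (by positivity))
    refine continuous_finsetSum _ fun i _ => continuous_finsetSum _ fun j _ => ?_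
    refine Continuous.rpow_const ?_ (fun _ => Or.inr hp0.le)
    exact (continuous_const.sub (continuous_id.matrix_elem i j)).abs
  have hent : ∀ (B : Matrix (Fin n) (Fin m) ℝ) i j, |B i j| ≤ lpNorm p B := by
    intro B i j
    unfold lpNorm
    have : |B i j| ^ p ≤ ∑ i, ∑ j, |B i j| ^ p := by
      refine (Finset.single_le_sum (f := fun j => |B i j| ^ p) (fun _ _ => by positivity)
        (mem_univ j)).trans ?_
      exact Finset.single_le_sum (f := fun i => ∑ j, |B i j| ^ p)
        (fun _ _ => Finset.sum_nonneg fun _ _ => by positivity) (mem_univ i)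
    calc |B i j| = (|B i j| ^ p) ^ (1 / p) := by
          rw [← Real.rpow_mul (abs_nonneg _), mul_one_div_cancel hp0.ne', Real.rpow_one]
      _ ≤ _ := Real.rpow_le_rpow (by positivity) this (by positivity)
  set R := lpNorm p (A - 0) with hR
  let K : Set (Matrix (Fin n) (Fin m) ℝ) := {X | ∀ i j, |(A - X) i j| ≤ R}
  have hK0 : IsCompact K := by
    have h : IsCompact (Set.pi Set.univ fun i : Fin n => Set.pi Set.univ fun j : Fin m =>
      Set.Icc (A i j - R) (A i j + R)) :=
      isCompact_univ_pi fun i => isCompact_univ_pi fun j => isCompact_Icc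
    have e : K = (Set.pi Set.univ fun i : Fin n => Set.pi Set.univ fun j : Fin m =>
      Set.Icc (A i j - R) (A i j + R)) := by
      apply Set.ext
      intro X
      constructor
      · intro hX i _ j _
        have := abs_le.1 (hX i j)
        simp only [Matrix.sub_apply] at this
        exact ⟨by linarith [this.2], by linarith [this.1]⟩
      · intro hX i j
        have h1 := hX i trivial j trivial
        have h2 : A i j - R ≤ X i j := h1.1
        have h3 : X i j ≤ A i j + R := h1.2
        rw [Matrix.sub_apply, abs_le]
        constructor <;> linarith
    rw [e]
    exact h
  have hK : IsCompact (K ∩ {X : Matrix (Fin n) (Fin m) ℝ | X.rank ≤ k}) :=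
    hK0.inter_right closed_rank
  have h0K : (0 : Matrix (Fin n) (Fin m) ℝ) ∈ K ∩ {X : Matrix (Fin n) (Fin m) ℝ | X.rank ≤ k} :=
    ⟨fun i j => hent (A - 0) i j, by simp⟩
  obtain ⟨X, hX, hmin⟩ := hK.exists_isMinOn ⟨0, h0K⟩ hcont.continuousOn
  refine ⟨X, hX.2, fun Z hZ => ?_⟩
  by_cases h : lpNorm p (A - Z) ≤ R
  · exact hmin ⟨fun i j => (hent (A - Z) i j).trans h, hZ⟩
  · have h0 : lpNorm p (A - X) ≤ R := hmin h0K
    linarith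

lemma main_X {n m k : ℕ} (hkm : k ≤ m)
    (p : ℝ) (hp1 : 1 ≤ p) (hp2 : p ≤ 2) (A X : Matrix (Fin n) (Fin m) ℝ) (hX : X.rank ≤ k) :
    ∃ (J : Fin k → Fin m) (Y : Matrix (Fin k) (Fin m) ℝ),
      ∑ i, ∑ j, |(A - A.submatrix id J * Y) i j| ^ p ≤
        ((k : ℝ) + 1) * ∑ i, ∑ j, |(A - X) i j| ^ p := by
  have hp0 : 0 < p := by linarith
  obtain ⟨U, V, hUV, J₀, hJ₀⟩ := exists_factor hkm X hX
  set d : (Fin k → Fin m) → ℝ := fun J => (V.submatrix id J).det with hd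
  have hswap : ∀ J i l, i ≠ l → d (J ∘ Equiv.swap i l) = - d J := by
    intro J i l h
    have := Matrix.det_permute' (Equiv.swap i l) (V.submatrix id J)
    rw [Equiv.Perm.sign_swap h] at this
    simpa [hd] using this
  have hcram : ∀ J j a, ∑ l, V a (J l) * d (Function.update J l j) = d J * V a j := by
    intro J j a
    have := congrFun (Matrix.mulVec_cramer (V.submatrix id J) (fun a => V a j)) a
    simp only [Matrix.mulVec, dotProduct, Matrix.cramer_apply, Pi.smul_apply, smul_eq_mul,
      Matrix.submatrix_apply, id] at this
    rw [hd]
    simp only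
    rw [← this]
    refine Finset.sum_congr rfl fun l _ => ?_
    congr 2
    ext x y
    by_cases h : y = l
    · subst h; simp
    · simp [h]
  have hXc : ∀ J j i, ∑ l, X i (J l) * d (Function.update J l j) = X i j * d J := by
    intro J j i
    simp only [hUV, Matrix.mul_apply, Finset.sum_mul]
    rw [Finset.sum_comm]
    refine Finset.sum_congr rfl fun a _ => ?_
    simp only [mul_assoc]
    rw [← Finset.mul_sum, hcram, mul_comm (d J)]
  let Y : (Fin k → Fin m) → Matrix (Fin k) (Fin m) ℝ := fun J =>
    Matrix.of fun l j => d (Function.update J l j) / d J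
  have hE : ∀ J i j, d J ≠ 0 → (A - X) i j * d J -
      ∑ l, (A - X) i (J l) * d (Function.update J l j) =
      (A - A.submatrix id J * Y J) i j * d J := by
    intro J i j hJ
    simp only [Matrix.sub_apply, sub_mul, Finset.sum_sub_distrib, hXc, Matrix.mul_apply, Y,
      Matrix.of_apply, Matrix.submatrix_apply, id, Finset.sum_mul]
    have : ∀ l, A i (J l) * (d (Function.update J l j) / d J) * d J =
        A i (J l) * d (Function.update J l j) := by intro l; field_simp
    simp only [this]
    ring
  set R : ℝ := ∑ i, ∑ j, |(A - X) i j| ^ p with hR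
  set F : (Fin k → Fin m) → ℝ := fun J => ∑ i, ∑ j, |(A - A.submatrix id J * Y J) i j| ^ p with hF
  by_contra hcon
  push Not at hcon
  have hFJ : ∀ J, (k + 1) * R < F J := fun J => hcon J (Y J)
  have h1 : ∑ J, |d J| ^ p * F J ≤ (k + 1) * (R * ∑ J, |d J| ^ p) := by
    have h2 : ∀ i, ∑ T : (Fin k → Fin m) × Fin m, |d T.1| ^ p *
        |(A - A.submatrix id T.1 * Y T.1) i T.2| ^ p ≤
        (k + 1) * ((∑ j, |(A - X) i j| ^ p) * ∑ J, |d J| ^ p) := by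
      intro i
      refine le_trans (Finset.sum_le_sum fun T _ => ?_)
        (exch_p p hp1 hp2 (fun j => (A - X) i j) d hswap)
      by_cases hJ : d T.1 = 0
      · simp only [hJ, abs_zero, Real.zero_rpow hp0.ne', zero_mul]; positivity
      · rw [hE _ _ _ hJ, abs_mul, Real.mul_rpow (abs_nonneg _) (abs_nonneg _), mul_comm]
    have h3 := Finset.sum_le_sum fun i (_ : i ∈ (univ : Finset (Fin n))) => h2 i
    rw [← Finset.mul_sum, ← Finset.sum_mul, ← hR] at h3
    refine le_trans (le_of_eq ?_) h3
    simp only [Fintype.sum_prod_type, hF, Finset.mul_sum]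
    rw [Finset.sum_comm]
  have h4 : ∑ J, |d J| ^ p * ((k + 1) * R) < ∑ J, |d J| ^ p * F J := by
    refine Finset.sum_lt_sum (fun J _ => ?_) ⟨J₀, mem_univ _, ?_⟩
    · exact mul_le_mul_of_nonneg_left (hFJ J).le (by positivity)
    · refine mul_lt_mul_of_pos_left (hFJ J₀) ?_
      exact Real.rpow_pos_of_pos (abs_pos.2 hJ₀) _
  rw [← Finset.sum_mul] at h4
  linarith

theorem column_subset_selection_upper_bound_p_le_two
    (n m k : ℕ) (hn : 0 < n) (hm : 0 < m) (hk : 0 < k) (hkm : k ≤ m)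
    (p : ℝ) (hp1 : 1 ≤ p) (hp2 : p ≤ 2) (A : Matrix (Fin n) (Fin m) ℝ) :
    ∃ (J : Fin k → Fin m) (Y : Matrix (Fin k) (Fin m) ℝ),
      lpNorm p (A - A.submatrix id J * Y) ≤
        ((k : ℝ) + 1) ^ (1 / p) *
          sInf {c : ℝ | ∃ X : Matrix (Fin n) (Fin m) ℝ,
            X.rank ≤ k ∧ c = lpNorm p (A - X)} := by
  obtain ⟨X, hX, hmin⟩ := exists_opt (k := k) p hp1 A
  obtain ⟨J, Y, hJ⟩ := main_X hkm p hp1 hp2 A X hX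
  refine ⟨J, Y, ?_⟩
  have hp0 : 0 < p := by linarith
  have h1 : lpNorm p (A - A.submatrix id J * Y) ≤ ((k : ℝ) + 1) ^ (1 / p) * lpNorm p (A - X) := by
    unfold lpNorm
    rw [← Real.mul_rpow (by positivity) (by positivity)]
    exact Real.rpow_le_rpow (by positivity) hJ (by positivity)
  refine h1.trans (mul_le_mul_of_nonneg_left ?_ (by positivity))
  refine le_csInf ⟨_, X, hX, rfl⟩ ?_
  rintro _ ⟨Z, hZ, rfl⟩
  exact hmin Z hZ
end

section
/- Let n, m, k be positive integers with k ≤ m, let 2 ≤ p < ∞, and let A ∈ ℝ^{n×m}. Then there exist a tuple J = (j_1, …, j_k) of column indices of A and a matrix Y ∈ ℝ^{k×m} such that ‖A − A_J Y‖_p ≤ (k+1)^{1−1/p} · inf{ ‖A − X‖_p : X ∈ ℝ^{n×m}, rank(X) ≤ k }. -/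
section CSS
open Finset Function

noncomputable def cssT {ι α : Type} (e : α → ℂ) (D : (ι → α) → ℂ)
    (q : α × (ι → α)) : ℂ := e q.1 * D q.2

def cssTau {ι α : Type} [DecidableEq ι] (i : ι) : (α × (ι → α)) ≃ (α × (ι → α)) where
  toFun q := (q.2 i, update q.2 i q.1)
  invFun q := (q.2 i, update q.2 i q.1)
  left_inv q := by simp
  right_inv q := by simp

noncomputable def cssS {ι α : Type} [Fintype ι] [DecidableEq ι] (e : α → ℂ) (D : (ι → α) → ℂ)
    (q : α × (ι → α)) : ℂ := cssT e D q - ∑ i, cssT e D (cssTau i q)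

lemma css_cross_nonneg {ι α : Type} [Fintype ι] [DecidableEq ι] [Fintype α] [Nonempty α]
    [DecidableEq α]
    (e : α → ℂ) (D : (ι → α) → ℂ) (i : ι) :
    0 ≤ ∑ q, (cssT e D q * starRingEnd ℂ (cssT e D (cssTau i q))).re := by
  have key : (Fintype.card α : ℝ) *
      ∑ q, (cssT e D q * starRingEnd ℂ (cssT e D (cssTau i q))).re =
      ∑ M : ι → α, ‖∑ l, e l * starRingEnd ℂ (D (update M i l))‖ ^ 2 := by
    have h1 : ∀ f : (ι → α) → ℝ, (Fintype.card α : ℝ) * ∑ M, f M =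
        ∑ M, ∑ a, f (update M i a) := by
      intro f
      calc (Fintype.card α : ℝ) * ∑ M, f M = ∑ q : α × (ι → α), f q.2 := by
            rw [Fintype.sum_prod_type]; simp
        _ = ∑ q : α × (ι → α), f (cssTau i q).2 := ((cssTau i).sum_comp (fun q => f q.2)).symm
        _ = _ := by rw [Fintype.sum_prod_type_right]; rfl
    rw [Fintype.sum_prod_type_right, h1]
    refine sum_congr rfl fun M _ => ?_
    have h2 : ∀ z : ℂ, ‖z‖ ^ 2 = (z * starRingEnd ℂ z).re := by
      intro z
      rw [Complex.mul_conj, Complex.normSq_eq_norm_sq]; exact (Complex.ofReal_re _).symm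
    rw [h2, map_sum, sum_mul_sum, Complex.re_sum, sum_comm]
    refine sum_congr rfl fun l _ => ?_
    rw [Complex.re_sum]
    refine sum_congr rfl fun a _ => ?_
    simp [cssT, cssTau]
    ring
  have hc : (0:ℝ) < Fintype.card α := by exact_mod_cast Fintype.card_pos
  by_contra! hneg
  have : (Fintype.card α : ℝ) *
      ∑ q, (cssT e D q * starRingEnd ℂ (cssT e D (cssTau i q))).re < 0 :=
    mul_neg_of_pos_of_neg hc hneg
  rw [key] at this
  exact absurd this (not_lt.mpr (sum_nonneg fun _ _ => by positivity))

lemma css_l2 {ι α : Type} [Fintype ι] [DecidableEq ι] [Fintype α] [Nonempty α] [DecidableEq α]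
    (e : α → ℂ) (D : (ι → α) → ℂ)
    (hD : ∀ M i j, i ≠ j → D (M ∘ Equiv.swap i j) = - D M) :
    ∑ q, ‖cssS e D q‖ ^ 2 ≤
      ((Fintype.card ι : ℝ) + 1) * ((∑ l, ‖e l‖ ^ 2) * ∑ M, ‖D M‖ ^ 2) := by
  have h2 : ∀ z : ℂ, ‖z‖ ^ 2 = (z * starRingEnd ℂ z).re := by
    intro z
    rw [Complex.mul_conj, Complex.normSq_eq_norm_sq]; exact (Complex.ofReal_re _).symm
  set N : ℝ := ∑ q, ‖cssT e D q‖ ^ 2 with hN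
  have hNe : N = (∑ l, ‖e l‖ ^ 2) * ∑ M, ‖D M‖ ^ 2 := by
    rw [hN, Fintype.sum_prod_type, sum_mul_sum]
    simp [cssT, mul_pow]
  rw [← hNe]
  have hpt : ∀ q, ‖cssS e D q‖ ^ 2 = ‖cssT e D q‖ ^ 2
      - 2 * ∑ i, (cssT e D q * starRingEnd ℂ (cssT e D (cssTau i q))).re
      + ∑ i, ∑ j, (cssT e D (cssTau i q) * starRingEnd ℂ (cssT e D (cssTau j q))).re := by
    intro q
    have h3 : ∑ i, ∑ j, (cssT e D (cssTau i q) * starRingEnd ℂ (cssT e D (cssTau j q))).re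
        = ((∑ i, cssT e D (cssTau i q)) * starRingEnd ℂ (∑ i, cssT e D (cssTau i q))).re := by
      rw [map_sum, sum_mul_sum, Complex.re_sum]
      simp only [Complex.re_sum]
    have h4 : ∑ i, (cssT e D q * starRingEnd ℂ (cssT e D (cssTau i q))).re
        = (cssT e D q * starRingEnd ℂ (∑ i, cssT e D (cssTau i q))).re := by
      rw [map_sum, mul_sum, Complex.re_sum]
    rw [h3, h4, h2, h2, cssS]
    simp
    ring
  simp only [hpt]
  rw [sum_add_distrib, sum_sub_distrib, ← mul_sum, sum_comm, ← hN]
  have hA : 0 ≤ ∑ i, ∑ q, (cssT e D q * starRingEnd ℂ (cssT e D (cssTau i q))).re :=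
    sum_nonneg fun i _ => css_cross_nonneg e D i
  have hB : ∑ q, ∑ i, ∑ j, (cssT e D (cssTau i q) * starRingEnd ℂ (cssT e D (cssTau j q))).re
      ≤ (Fintype.card ι : ℝ) * N := by
    rw [sum_comm]
    have : ∀ i, ∑ q, ∑ j, (cssT e D (cssTau i q) * starRingEnd ℂ (cssT e D (cssTau j q))).re
        ≤ N := by
      intro i
      rw [sum_comm]
      calc _ ≤ ∑ j, if i = j then N else 0 := by
            refine sum_le_sum fun j _ => ?_
            split_ifs with hij
            · subst hij
              rw [hN, ← (cssTau i).sum_comp (fun q => ‖cssT e D q‖ ^ 2)]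
              simp only [h2]; exact le_rfl
            · rw [← (cssTau i).sum_comp]
              have := css_cross_nonneg e D j
              have h5 : ∀ q, (cssT e D (cssTau i (cssTau i q)) *
                  starRingEnd ℂ (cssT e D (cssTau j (cssTau i q)))).re =
                  - (cssT e D q * starRingEnd ℂ (cssT e D (cssTau j q))).re := by
                intro q
                have h6 : cssTau i (cssTau i q) = q := (cssTau i).left_inv q
                have h7 : cssT e D (cssTau j (cssTau i q)) = - cssT e D (cssTau j q) := by
                  have : update (update q.2 i q.1) j (q.2 i) =
                      (update q.2 j q.1) ∘ Equiv.swap i j := by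
                    funext x
                    by_cases hxj : x = j
                    · subst hxj; simp [hij]
                    · by_cases hxi : x = i
                      · subst hxi; simp [hij]
                      · simp [hxi, hxj, Equiv.swap_apply_of_ne_of_ne hxi hxj]
                  simp only [cssT, cssTau, Equiv.coe_fn_mk]
                  rw [update_of_ne (Ne.symm hij)]
                  rw [this, hD _ _ _ hij]
                  ring
                rw [h6, h7]; simp
              simp only [h5, sum_neg_distrib]
              linarith
        _ = N := by simp
    calc _ ≤ ∑ i : ι, N := sum_le_sum fun i _ => this i
      _ = _ := by simp
  linarith


noncomputable def cssPw (x : ℝ) (w : ℂ) : ℂ :=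
  (Real.sign x : ℂ) * Complex.exp (w * (Real.log |x| : ℂ))

lemma cssPw_neg (x : ℝ) (w : ℂ) : cssPw (-x) w = - cssPw x w := by
  simp [cssPw, Real.sign_neg]

lemma cssPw_zero (w : ℂ) : cssPw 0 w = 0 := by simp [cssPw]

lemma cssPw_norm (x : ℝ) (hx : x ≠ 0) (w : ℂ) : ‖cssPw x w‖ = |x| ^ w.re := by
  rw [cssPw, norm_mul, Complex.norm_exp, Real.rpow_def_of_pos (abs_pos.mpr hx)]
  have : ‖(Real.sign x : ℂ)‖ = 1 := by
    rcases Real.sign_apply_eq_of_ne_zero x hx with h | h <;> simp [h]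
  rw [this, one_mul]
  simp [mul_comm]

lemma cssPw_norm' (x : ℝ) (w : ℂ) (hw : w.re ≠ 0) : ‖cssPw x w‖ = |x| ^ w.re := by
  by_cases hx : x = 0
  · subst hx; simp [cssPw_zero, Real.zero_rpow hw]
  · exact cssPw_norm x hx w

lemma cssPw_norm_le_one (x : ℝ) (w : ℂ) (hw : w.re = 0) : ‖cssPw x w‖ ≤ 1 := by
  by_cases hx : x = 0
  · subst hx; simp [cssPw_zero]
  · rw [cssPw_norm x hx w, hw, Real.rpow_zero]

lemma cssPw_bdd (x : ℝ) (w : ℂ) (p : ℝ) (h0 : 0 ≤ w.re) (h1 : w.re ≤ p) :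
    ‖cssPw x w‖ ≤ Real.exp (p * |Real.log (|x|)|) := by
  by_cases hx : x = 0
  · subst hx; rw [cssPw_zero, norm_zero]; positivity
  · rw [cssPw_norm x hx w, Real.rpow_def_of_pos (abs_pos.mpr hx), mul_comm]
    apply Real.exp_le_exp.mpr
    calc w.re * Real.log |x| ≤ w.re * |Real.log (|x|)| :=
          mul_le_mul_of_nonneg_left (le_abs_self _) h0
      _ ≤ _ := mul_le_mul_of_nonneg_right h1 (abs_nonneg _)

lemma cssPw_real (x : ℝ) (r : ℝ) (_hr : r ≠ 0) : cssPw x r = Real.sign x * ((|x| ^ r : ℝ) : ℂ) := by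
  by_cases hx : x = 0
  · subst hx; simp [cssPw_zero]
  · rw [cssPw, Real.rpow_def_of_pos (abs_pos.mpr hx), mul_comm (r : ℂ)]
    push_cast; rfl

lemma cssPw_one (x : ℝ) : cssPw x 1 = x := by
  have := cssPw_real x 1 one_ne_zero
  rw [Real.rpow_one] at this
  rw [← Complex.ofReal_mul] at this
  rw [Complex.ofReal_one] at this
  rw [this]
  congr 1
  rcases lt_trichotomy x 0 with h | h | h
  · rw [Real.sign_of_neg h, abs_of_neg h]; ring
  · subst h; simp
  · rw [Real.sign_of_pos h, abs_of_pos h]; ring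

lemma cssPw_dual (x : ℝ) (p : ℝ) (hp : 2 ≤ p) :
    (x : ℂ) * cssPw x ((p - 1 : ℝ) : ℂ) = ((|x| ^ p : ℝ) : ℂ) := by
  rw [cssPw_real x _ (by linarith), ← Complex.ofReal_mul, ← Complex.ofReal_mul]
  congr 1
  by_cases hx : x = 0
  · subst hx; simp [Real.zero_rpow (show p ≠ 0 by linarith)]
  have hxs : x * Real.sign x = |x| := by
    rcases lt_or_gt_of_ne hx with h | h
    · rw [Real.sign_of_neg h, abs_of_neg h]; ring
    · rw [Real.sign_of_pos h, abs_of_pos h]; ring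
  rw [← mul_assoc, hxs, Real.rpow_sub_one (abs_ne_zero.mpr hx)]
  field_simp

lemma cssS_norm_le {ι α : Type} [Fintype ι] [DecidableEq ι] (e : α → ℂ) (D : (ι → α) → ℂ)
    (K : α → ℝ) (L : (ι → α) → ℝ) (hK : ∀ l, ‖e l‖ ≤ K l) (hL : ∀ M, ‖D M‖ ≤ L M)
    (q : α × (ι → α)) :
    ‖cssS e D q‖ ≤ K q.1 * L q.2 + ∑ i, K (cssTau i q).1 * L (cssTau i q).2 := by
  have h : ∀ q, ‖cssT e D q‖ ≤ K q.1 * L q.2 := by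
    intro q
    rw [cssT, norm_mul]
    exact mul_le_mul (hK _) (hL _) (norm_nonneg _) ((norm_nonneg _).trans (hK _))
  refine (norm_sub_le _ _).trans (add_le_add (h q) ((norm_sum_le _ _).trans ?_))
  exact sum_le_sum fun i _ => h _

lemma css_lp {ι α : Type} [Fintype ι] [DecidableEq ι] [Fintype α] [Nonempty α] [DecidableEq α]
    (p : ℝ) (hp : 2 ≤ p) (e : α → ℝ) (D : (ι → α) → ℝ)
    (hD : ∀ M i j, i ≠ j → D (M ∘ Equiv.swap i j) = - D M) :
    ∑ q : α × (ι → α), |e q.1 * D q.2 - ∑ i, e (q.2 i) * D (update q.2 i q.1)| ^ p ≤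
      ((Fintype.card ι : ℝ) + 1) ^ (p - 1) * ((∑ l, |e l| ^ p) * ∑ M, |D M| ^ p) := by
  have hp0 : 0 < p := by linarith
  set s : α × (ι → α) → ℝ :=
    fun q => e q.1 * D q.2 - ∑ i, e (q.2 i) * D (update q.2 i q.1) with hs
  change ∑ q, |s q| ^ p ≤ _
  set N := ∑ q, |s q| ^ p with hN
  set G := (∑ l, |e l| ^ p) * ∑ M, |D M| ^ p with hG
  set c : ℝ := (Fintype.card ι : ℝ) + 1 with hc
  have hc0 : 0 < c := by positivity
  have hN0 : 0 ≤ N := sum_nonneg fun _ _ => by positivity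
  have hG0 : 0 ≤ G := mul_nonneg (sum_nonneg fun _ _ => by positivity)
    (sum_nonneg fun _ _ => by positivity)
  let ez : ℂ → α → ℂ := fun z l => cssPw (e l) (p * (1 - z) / 2)
  let Dz : ℂ → (ι → α) → ℂ := fun z M => cssPw (D M) (p * (1 - z) / 2)
  let hz : ℂ → α × (ι → α) → ℂ := fun z q => cssPw (s q) (p * (1 + z) / 2)
  let F : ℂ → ℂ := fun z => ∑ q, cssS (ez z) (Dz z) q * hz z q
  have hre1 : ∀ z : ℂ, ((p : ℂ) * (1 - z) / 2).re = p * (1 - z.re) / 2 := by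
    intro z
    rw [show (p : ℂ) * (1 - z) / 2 = ((p / 2 : ℝ) : ℂ) * (1 - z) by push_cast; ring,
      Complex.re_ofReal_mul]; simp; ring
  have hre2 : ∀ z : ℂ, ((p : ℂ) * (1 + z) / 2).re = p * (1 + z.re) / 2 := by
    intro z
    rw [show (p : ℂ) * (1 + z) / 2 = ((p / 2 : ℝ) : ℂ) * (1 + z) by push_cast; ring,
      Complex.re_ofReal_mul]; simp; ring
  have hdiff : Differentiable ℂ F := by
    simp only [F, cssS, cssT, ez, Dz, hz, cssPw]
    fun_prop
  have hbdd : BddAbove ((norm ∘ F) '' Complex.HadamardThreeLines.verticalClosedStrip 0 1) := by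
    let K : α → ℝ := fun l => Real.exp (p * |Real.log (|e l|)|)
    let L : (ι → α) → ℝ := fun M => Real.exp (p * |Real.log (|D M|)|)
    refine ⟨∑ q : α × (ι → α), (K q.1 * L q.2 + ∑ i, K (cssTau i q).1 * L (cssTau i q).2) *
      Real.exp (p * |Real.log (|s q|)|), ?_⟩
    rintro _ ⟨z, hzz, rfl⟩
    obtain ⟨hz0, hz1⟩ : 0 ≤ z.re ∧ z.re ≤ 1 := hzz
    refine (norm_sum_le _ _).trans (sum_le_sum fun q _ => ?_)
    rw [norm_mul]
    refine mul_le_mul ?_ ?_ (norm_nonneg _) (by positivity)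
    · refine cssS_norm_le _ _ K L ?_ ?_ q
      · intro l
        refine cssPw_bdd _ _ _ ?_ ?_ <;> rw [hre1] <;> nlinarith
      · intro l
        refine cssPw_bdd _ _ _ ?_ ?_ <;> rw [hre1] <;> nlinarith
    · refine cssPw_bdd _ _ _ ?_ ?_ <;> rw [hre2] <;> nlinarith
  have hsq : ∀ (x : ℝ), (|x| ^ (p / 2)) ^ 2 = |x| ^ p := by
    intro x
    rw [← Real.rpow_natCast, ← Real.rpow_mul (abs_nonneg _)]
    congr 1; push_cast; ring
  have ha : ∀ z ∈ Complex.re ⁻¹' {0}, ‖F z‖ ≤ Real.sqrt (c * G) * Real.sqrt N := by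
    intro z hzz
    have hz0 : z.re = 0 := hzz
    have e1 : ∀ x : ℝ, ‖cssPw x (p * (1 - z) / 2)‖ ^ 2 = |x| ^ p := by
      intro x
      have : ((p : ℂ) * (1 - z) / 2).re = p / 2 := by rw [hre1, hz0]; ring
      rw [cssPw_norm' _ _ (by rw [this]; positivity), this, hsq]
    have e2 : ∀ x : ℝ, ‖cssPw x (p * (1 + z) / 2)‖ ^ 2 = |x| ^ p := by
      intro x
      have : ((p : ℂ) * (1 + z) / 2).re = p / 2 := by rw [hre2, hz0]; ring
      rw [cssPw_norm' _ _ (by rw [this]; positivity), this, hsq]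
    have h1 := css_l2 (ez z) (Dz z) (by
      intro M i j hij
      simp only [Dz]
      rw [hD M i j hij, cssPw_neg])
    simp only [ez, Dz, e1] at h1
    calc ‖F z‖ ≤ ∑ q, ‖cssS (ez z) (Dz z) q‖ * ‖hz z q‖ := by
          refine (norm_sum_le _ _).trans (le_of_eq ?_)
          simp only [norm_mul]
      _ ≤ Real.sqrt (∑ q, ‖cssS (ez z) (Dz z) q‖ ^ 2) * Real.sqrt (∑ q, ‖hz z q‖ ^ 2) :=
          Real.sum_mul_le_sqrt_mul_sqrt _ _ _
      _ ≤ _ := by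
          refine mul_le_mul (Real.sqrt_le_sqrt h1) (Real.sqrt_le_sqrt ?_) (by positivity)
            (by positivity)
          simp only [hz, e2]; exact le_rfl
  have hb : ∀ z ∈ Complex.re ⁻¹' {1}, ‖F z‖ ≤ c * N := by
    intro z hzz
    have hz1 : z.re = 1 := hzz
    rw [hN, mul_sum]
    refine (norm_sum_le _ _).trans (sum_le_sum fun q _ => ?_)
    rw [norm_mul]
    refine mul_le_mul ?_ ?_ (norm_nonneg _) (by positivity)
    · refine (cssS_norm_le _ _ (fun _ => 1) (fun _ => 1) ?_ ?_ q).trans ?_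
      · intro l; exact cssPw_norm_le_one _ _ (by rw [hre1, hz1]; ring)
      · intro l; exact cssPw_norm_le_one _ _ (by rw [hre1, hz1]; ring)
      · simp [hc, add_comm]
    · have : ((p : ℂ) * (1 + z) / 2).re = p := by rw [hre2, hz1]; ring
      simp only [hz]
      rw [cssPw_norm' _ _ (by rw [this]; positivity), this]
  set θ : ℝ := 1 - 2 / p with hθ
  have h2p : 2 / p ≤ 1 := by rw [div_le_one hp0]; exact hp
  have h2p0 : 0 < 2 / p := by positivity
  have hmem : (θ : ℂ) ∈ Complex.HadamardThreeLines.verticalClosedStrip 0 1 := by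
    constructor <;> simp <;> linarith
  have main := Complex.HadamardThreeLines.norm_le_interp_of_mem_verticalClosedStrip₀₁' F hmem
    hdiff.diffContOnCl hbdd ha hb
  have hpc : (p : ℂ) ≠ 0 := by exact_mod_cast hp0.ne'
  have hF : F θ = (N : ℂ) := by
    simp only [F, hN, Complex.ofReal_sum]
    refine sum_congr rfl fun q _ => ?_
    have e1 : (p : ℂ) * (1 - (θ : ℂ)) / 2 = 1 := by
      rw [hθ]; push_cast; field_simp; ring
    have e2 : (p : ℂ) * (1 + (θ : ℂ)) / 2 = ((p - 1 : ℝ) : ℂ) := by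
      rw [hθ]; push_cast; field_simp; ring
    rw [← cssPw_dual _ _ hp]
    simp only [hz, ez, Dz, e1, e2, cssPw_one]
    congr 1
    simp [cssS, cssT, cssTau, hs]
  rw [hF, Complex.norm_real, Real.norm_of_nonneg hN0, Complex.ofReal_re] at main
  rcases hN0.eq_or_lt with h0 | hNpos
  · rw [← h0]; positivity
  have hq : 1 - θ = 2 / p := by rw [hθ]; ring
  have e3 : (Real.sqrt (c * G) * Real.sqrt N) ^ (1 - θ) = (c * G * N) ^ (1 / p) := by
    rw [← Real.sqrt_mul (by positivity), Real.sqrt_eq_rpow, ← Real.rpow_mul (by positivity), hq]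
    congr 1; field_simp
  rw [e3] at main
  -- raise to the power p
  have h5 : N ^ p ≤ (c * G * N) * (c * N) ^ (p - 2) := by
    calc N ^ p ≤ ((c * G * N) ^ (1 / p) * (c * N) ^ θ) ^ p :=
          Real.rpow_le_rpow hN0 main hp0.le
      _ = _ := by
          rw [Real.mul_rpow (by positivity) (by positivity), ← Real.rpow_mul (by positivity),
            ← Real.rpow_mul (by positivity)]
          rw [one_div_mul_cancel hp0.ne', Real.rpow_one]
          congr 2
          rw [hθ]; field_simp
  have h6 : (c * G * N) * (c * N) ^ (p - 2) = (c ^ (p - 1) * G) * N ^ (p - 1) := by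
    rw [Real.mul_rpow hc0.le hN0, show p - 1 = (p - 2) + 1 by ring, Real.rpow_add_one hc0.ne',
      Real.rpow_add_one hNpos.ne']
    ring
  have h7 : N ^ p = N * N ^ (p - 1) := by
    rw [Real.rpow_sub_one hNpos.ne']; field_simp
  rw [h6, h7] at h5
  exact le_of_mul_le_mul_right h5 (by positivity)

lemma css_select {n m r : ℕ} (hm : 0 < m) (p : ℝ) (hp : 2 ≤ p) (A : Matrix (Fin n) (Fin m) ℝ)
    (U : Matrix (Fin n) (Fin r) ℝ) (V : Matrix (Fin r) (Fin m) ℝ) (J0 : Fin r → Fin m)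
    (hJ0 : (V.submatrix id J0).det ≠ 0) :
    ∃ (J : Fin r → Fin m) (Y : Matrix (Fin r) (Fin m) ℝ),
      ∑ i, ∑ j, |(A - A.submatrix id J * Y) i j| ^ p ≤
        ((r : ℝ) + 1) ^ (p - 1) * ∑ i, ∑ j, |(A - U * V) i j| ^ p := by
  have : Nonempty (Fin m) := ⟨⟨0, hm⟩⟩
  have hp0 : 0 < p := by linarith
  set E := A - U * V with hE
  let D : (Fin r → Fin m) → ℝ := fun M => (V.submatrix id M).det
  have hD : ∀ M i j, i ≠ j → D (M ∘ Equiv.swap i j) = - D M := by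
    intro M i j hij
    have := Matrix.det_permute' (Equiv.swap i j) (V.submatrix id M)
    rw [Matrix.submatrix_submatrix, Equiv.Perm.sign_swap hij] at this
    simpa using this
  have hupd : ∀ M i l, (V.submatrix id M).cramer (fun t => V t l) i = D (update M i l) := by
    intro M i l
    rw [Matrix.cramer_apply]
    simp only [D]
    congr 1
    ext a b
    by_cases hb : b = i
    · subst hb; simp
    · simp [hb]
  let Y : (Fin r → Fin m) → Matrix (Fin r) (Fin m) ℝ :=
    fun M => Matrix.of fun i l => D (update M i l) / D M
  have hkey : ∀ M, D M ≠ 0 → ∀ i l, D M * (A - A.submatrix id M * Y M) i l =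
      E i l * D M - ∑ t, E i (M t) * D (update M t l) := by
    intro M hM i l
    have h1 : ∑ t, (U * V) i (M t) * D (update M t l) = (U * V) i l * D M := by
      have h2 := Matrix.mulVec_cramer (V.submatrix id M) (fun t => V t l)
      have h3 : ∀ a, ∑ t, V a (M t) * D (update M t l) = D M * V a l := by
        intro a
        have := congrFun h2 a
        simpa [Matrix.mulVec, dotProduct, hupd] using this
      simp only [Matrix.mul_apply, sum_mul]
      rw [sum_comm]
      refine sum_congr rfl fun a _ => ?_
      calc _ = U i a * ∑ t, V a (M t) * D (update M t l) := by
            rw [mul_sum]; exact sum_congr rfl fun t _ => by ring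
        _ = _ := by rw [h3]; ring
    have h4 : D M * (A.submatrix id M * Y M) i l = ∑ t, A i (M t) * D (update M t l) := by
      rw [Matrix.mul_apply, mul_sum]
      refine sum_congr rfl fun t _ => ?_
      simp only [Y, Matrix.of_apply, Matrix.submatrix_apply, id]
      field_simp
    simp only [hE, Matrix.sub_apply, sub_mul, sum_sub_distrib]
    rw [h1, mul_sub, h4]
    ring
  by_contra! hcon
  set C := ((r : ℝ) + 1) ^ (p - 1) * ∑ i, ∑ j, |E i j| ^ p with hC
  have hlt : ∑ M, |D M| ^ p * C <
      ∑ M, |D M| ^ p * ∑ i, ∑ j, |(A - A.submatrix id M * Y M) i j| ^ p := by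
    refine sum_lt_sum (fun M _ => ?_) ⟨J0, mem_univ _, ?_⟩
    · exact mul_le_mul_of_nonneg_left (hcon M (Y M)).le (by positivity)
    · have : 0 < |D J0| := abs_pos.mpr hJ0
      exact mul_lt_mul_of_pos_left (hcon J0 (Y J0)) (by positivity)
  have hle : ∑ M, |D M| ^ p * ∑ i, ∑ j, |(A - A.submatrix id M * Y M) i j| ^ p ≤
      ∑ M, |D M| ^ p * C := by
    calc _ ≤ ∑ M, ∑ i, ∑ l, |E i l * D M - ∑ t, E i (M t) * D (update M t l)| ^ p := by
          refine sum_le_sum fun M _ => ?_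
          by_cases hM : D M = 0
          · rw [hM, abs_zero, Real.zero_rpow hp0.ne', zero_mul]
            positivity
          · simp only [mul_sum]
            refine sum_le_sum fun i _ => sum_le_sum fun l _ => ?_
            rw [← hkey M hM, abs_mul, Real.mul_rpow (abs_nonneg _) (abs_nonneg _)]
      _ = ∑ i, ∑ q : Fin m × (Fin r → Fin m),
            |E i q.1 * D q.2 - ∑ t, E i (q.2 t) * D (update q.2 t q.1)| ^ p := by
          rw [sum_comm]
          refine sum_congr rfl fun i _ => ?_
          rw [Fintype.sum_prod_type_right]
      _ ≤ ∑ i, ((r : ℝ) + 1) ^ (p - 1) * ((∑ l, |E i l| ^ p) * ∑ M, |D M| ^ p) := by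
          refine sum_le_sum fun i _ => ?_
          have := css_lp p hp (E i) D hD
          rwa [Fintype.card_fin] at this
      _ = _ := by
          rw [← mul_sum, ← sum_mul, ← sum_mul, hC]; ring
  exact absurd hlt (not_lt.mpr hle)

lemma css_factor {n m : ℕ} (X : Matrix (Fin n) (Fin m) ℝ) :
    ∃ (U : Matrix (Fin n) (Fin X.rank) ℝ) (V : Matrix (Fin X.rank) (Fin m) ℝ)
      (J0 : Fin X.rank → Fin m), X = U * V ∧ (V.submatrix id J0).det ≠ 0 := by
  have hex : ∃ f : Fin X.rank → (Fin n → ℝ), (∀ i, f i ∈ Set.range X.col) ∧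
      Submodule.span ℝ (Set.range f) = Submodule.span ℝ (Set.range X.col) ∧
      LinearIndependent ℝ f := by
    rw [Matrix.rank_eq_finrank_span_cols]
    exact Submodule.exists_fun_fin_finrank_span_eq ℝ (Set.range X.col)
  obtain ⟨f, hf, hspan, hli⟩ := hex
  choose J0 hJ0 using hf
  have hmem : ∀ l, X.col l ∈ Submodule.span ℝ (Set.range f) := by
    intro l; rw [hspan]; exact Submodule.subset_span ⟨l, rfl⟩
  choose v hv using fun l => (Submodule.mem_span_range_iff_exists_fun ℝ).mp (hmem l)
  refine ⟨Matrix.of fun i t => f t i, Matrix.of fun t l => v l t, J0, ?_, ?_⟩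
  · ext i l
    have := congrFun (hv l) i
    simp only [Finset.sum_apply, Pi.smul_apply, smul_eq_mul] at this
    rw [Matrix.mul_apply]
    simp only [Matrix.of_apply]
    calc X i l = X.col l i := rfl
      _ = _ := by rw [← this]; exact sum_congr rfl fun t _ => mul_comm _ _
  · have : (Matrix.of fun t l => v l t).submatrix id J0 = (1 : Matrix (Fin X.rank) _ ℝ) := by
      ext a b
      have h1 := hv (J0 b)
      rw [hJ0 b] at h1
      have h2 : ∑ i, v (J0 b) i • f i = ∑ i, (Pi.single b 1 : Fin X.rank → ℝ) i • f i := by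
        rw [h1]; simp [Pi.single_apply]
      have h3 := Fintype.linearIndependent_iff.mp hli (fun i => v (J0 b) i - (Pi.single b 1 : Fin X.rank → ℝ) i)
        (by simp only [sub_smul, sum_sub_distrib, h2, sub_self]) a
      simp only [Matrix.submatrix_apply, Matrix.of_apply, id]
      rw [Matrix.one_apply, sub_eq_zero.mp h3, Pi.single_apply]
    rw [this]; simp

lemma css_pad {n m r k : ℕ} (hm : 0 < m) (hrk : r ≤ k) (A : Matrix (Fin n) (Fin m) ℝ)
    (J : Fin r → Fin m) (Y : Matrix (Fin r) (Fin m) ℝ) :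
    ∃ (J' : Fin k → Fin m) (Y' : Matrix (Fin k) (Fin m) ℝ),
      A.submatrix id J' * Y' = A.submatrix id J * Y := by
  have hinj := Fin.castLE_injective hrk
  refine ⟨extend (Fin.castLE hrk) J (fun _ => ⟨0, hm⟩), 
    Matrix.of fun t l => extend (Fin.castLE hrk) (fun a => Y a l) 0 t, ?_⟩
  ext i l
  rw [Matrix.mul_apply, Matrix.mul_apply]
  symm
  refine Fintype.sum_of_injective _ hinj _ _ ?_ ?_
  · intro t ht
    have : ¬ ∃ a, Fin.castLE hrk a = t := ht
    simp only [Matrix.of_apply]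
    rw [extend_apply' _ _ _ this]; simp
  · intro t
    simp only [Matrix.of_apply, Matrix.submatrix_apply]
    rw [hinj.extend_apply, hinj.extend_apply]

lemma css_attain {n m k : ℕ} (p : ℝ) (hp : 2 ≤ p) (A : Matrix (Fin n) (Fin m) ℝ)
    (B : Matrix (Fin n) (Fin k) ℝ) :
    ∃ Y : Matrix (Fin k) (Fin m) ℝ, ∀ Y' : Matrix (Fin k) (Fin m) ℝ,
      lpNorm p (A - B * Y) ≤ lpNorm p (A - B * Y') := by
  have hp0 : 0 < p := by linarith
  have : Fact (1 ≤ ENNReal.ofReal p) := ⟨by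
    rw [← ENNReal.ofReal_one]; exact ENNReal.ofReal_le_ofReal (by linarith)⟩
  have hpr : (ENNReal.ofReal p).toReal = p := ENNReal.toReal_ofReal hp0.le
  let S := PiLp (ENNReal.ofReal p) (fun _ : Fin n × Fin m => ℝ)
  let T : Matrix (Fin n) (Fin m) ℝ → S := fun X => WithLp.toLp _ (fun q => X q.1 q.2)
  have hT : ∀ X, ‖T X‖ = lpNorm p X := by
    intro X
    rw [PiLp.norm_eq_sum (by rw [hpr]; exact hp0), hpr, lpNorm, Fintype.sum_prod_type]
    rfl
  let L : Matrix (Fin k) (Fin m) ℝ →ₗ[ℝ] S :=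
    { toFun := fun Y => T (B * Y)
      map_add' := fun a b => by
        ext q; 
        change (B * (a + b)) q.1 q.2 = (B * a) q.1 q.2 + (B * b) q.1 q.2
        rw [Matrix.mul_add]; rfl
      map_smul' := fun a b => by
        ext q
        change (B * (a • b)) q.1 q.2 = a * (B * b) q.1 q.2
        rw [Matrix.mul_smul]; rfl }
  have hcl : IsClosed (LinearMap.range L : Set S) := Submodule.closed_of_finiteDimensional _
  obtain ⟨y, ⟨Y, rfl⟩, hy⟩ := hcl.exists_infDist_eq_dist ⟨0, Submodule.zero_mem _⟩ (T A)
  have hd : ∀ Y, dist (T A) (L Y) = lpNorm p (A - B * Y) := by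
    intro Y
    rw [dist_eq_norm, ← hT]
    congr 1
  refine ⟨Y, fun Y' => ?_⟩
  rw [← hd, ← hd, ← hy]
  exact Metric.infDist_le_dist_of_mem ⟨Y', rfl⟩

lemma css_each {n m k : ℕ} (hm : 0 < m) (p : ℝ) (hp : 2 ≤ p) (A X : Matrix (Fin n) (Fin m) ℝ)
    (hX : X.rank ≤ k) :
    ∃ (J : Fin k → Fin m) (Y : Matrix (Fin k) (Fin m) ℝ),
      lpNorm p (A - A.submatrix id J * Y) ≤ ((k : ℝ) + 1) ^ (1 - 1 / p) * lpNorm p (A - X) := by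
  have hp0 : 0 < p := by linarith
  obtain ⟨U, V, J0, hUV, hdet⟩ := css_factor X
  obtain ⟨J, Y, h⟩ := css_select hm p hp A U V J0 hdet
  rw [← hUV] at h
  obtain ⟨J', Y', h'⟩ := css_pad hm hX A J Y
  refine ⟨J', Y', ?_⟩
  rw [h']
  have hr : (X.rank : ℝ) ≤ k := by exact_mod_cast hX
  have h1 : ((X.rank : ℝ) + 1) ^ (p - 1) ≤ ((k : ℝ) + 1) ^ (p - 1) :=
    Real.rpow_le_rpow (by positivity) (by linarith) (by linarith)
  have h2 := h.trans (mul_le_mul_of_nonneg_right h1 (by positivity))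
  have h3 := Real.rpow_le_rpow (by positivity) h2 (by positivity : 0 ≤ 1 / p)
  rw [Real.mul_rpow (by positivity) (by positivity), ← Real.rpow_mul (by positivity)] at h3
  rw [lpNorm, lpNorm]
  convert h3 using 3
  field_simp

end CSS

theorem column_subset_selection_upper_bound_p_ge_two
    (n m k : ℕ) (hn : 0 < n) (hm : 0 < m) (hk : 0 < k) (hkm : k ≤ m)
    (p : ℝ) (hp1 : 2 ≤ p) (A : Matrix (Fin n) (Fin m) ℝ) :
    ∃ (J : Fin k → Fin m) (Y : Matrix (Fin k) (Fin m) ℝ),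
      lpNorm p (A - A.submatrix id J * Y) ≤
        ((k : ℝ) + 1) ^ (1 - 1 / p) *
          sInf {c : ℝ | ∃ X : Matrix (Fin n) (Fin m) ℝ,
            X.rank ≤ k ∧ c = lpNorm p (A - X)} := by
  have : Nonempty (Fin m) := ⟨⟨0, hm⟩⟩
  choose Y hY using fun J : Fin k → Fin m => css_attain p hp1 A (A.submatrix id J)
  obtain ⟨J, hJ⟩ := Finite.exists_min (fun J => lpNorm p (A - A.submatrix id J * Y J))
  refine ⟨J, Y J, ?_⟩
  have hC : 0 < ((k : ℝ) + 1) ^ (1 - 1 / p) := by positivity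
  rw [← div_le_iff₀' hC]
  refine le_csInf ⟨_, 0, by simp, rfl⟩ ?_
  rintro _ ⟨X, hX, rfl⟩
  rw [div_le_iff₀' hC]
  obtain ⟨J', Y', h⟩ := css_each hm p hp1 A X hX
  exact (hJ J').trans ((hY J' Y').trans h)
end
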